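/- For every finite undirected graph H and every vertex v of H, Ent(H) ≤ Ent(H \ v) + 1, where H \ v denotes the graph obtained from H by deleting the vertex v (together with all edges incident to it). -/

import Mathlib

/-!
The entanglement game `Ent(G,k)` on a graph with adjacency relation
`E : V → V → Prop` is played by Robber against `k` cops.  Positions are
`(v, C, P)` with `v : V`, `C : Finset V` with `C.card ≤ k`, and
`P ∈ {Cops, Robber}`.  Initially Robber chooses `v₀` and moves to
`(v₀, ∅, Cops)`.  From `(v, C, Cops)`, Cops may skip, add a cop on `v`
(if at most `k` cops are then placed), or move a placed cop to `v`; from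
`(v, C, Robber)`, Robber moves along an edge to a vertex free of cops.
Every finite play is a win for Cops, so "Cops have a winning strategy from
`(v, C, Cops)`" is the inductive predicate `EntCopsWinFrom`.  The
entanglement of the graph is the least `k` such that Cops have a winning
strategy in `Ent(G,k)` (it is at most the number of vertices).
-/

variable {V : Type*} [DecidableEq V]

/-- A legal Cops move in the game `Ent(G,k)`: from position `(v, C, Cops)`
Cops may go to `(v, C', Robber)` where `C'` is `C` (skip), `C ∪ {v}` provided
at most `k` cops are used (add), or `(C \ {x}) ∪ {v}` for some `x ∈ C`
(move a placed cop). -/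
def EntCopsMove (k : ℕ) (v : V) (C C' : Finset V) : Prop :=
  C' = C ∨ (C' = insert v C ∧ (insert v C).card ≤ k) ∨
    ∃ x ∈ C, C' = insert v (C.erase x)

/-- Cops have a winning strategy in `Ent(G,k)` from position `(v, C, Cops)`. -/
inductive EntCopsWinFrom (E : V → V → Prop) (k : ℕ) : V → Finset V → Prop
  | step (v : V) (C C' : Finset V) (hmove : EntCopsMove k v C C')
      (h : ∀ v', E v v' → v' ∉ C' → EntCopsWinFrom E k v' C') :
      EntCopsWinFrom E k v C

/-- Cops have a winning strategy in the game `Ent(G,k)`. -/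
def EntCopsWin (E : V → V → Prop) (k : ℕ) : Prop :=
  ∀ v : V, EntCopsWinFrom E k v ∅

/-- The entanglement of a graph: the least number `k` of cops such that Cops
have a winning strategy in the game `Ent(G,k)`. -/
noncomputable def entanglement (E : V → V → Prop) : ℕ :=
  sInf {k | EntCopsWin E k}

theorem EntCopsMove.card_le {V : Type*} [DecidableEq V] {k : ℕ} {w : V} {C C' : Finset V}
    (h : EntCopsMove k w C C') (hC : C.card ≤ k) : C'.card ≤ k := by
  rcases h with rfl | ⟨rfl, h⟩ | ⟨x, hx, rfl⟩
  · exact hC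
  · exact h
  · have h₁ := Finset.card_insert_le w (C.erase x)
    have h₂ := Finset.card_erase_add_one hx
    omega

theorem EntCopsMove.mono {V : Type*} [DecidableEq V] {k l : ℕ} (hkl : k ≤ l) {w : V}
    {C C' : Finset V} (h : EntCopsMove k w C C') : EntCopsMove l w C C' := by
  rcases h with h | ⟨h, hk⟩ | h
  · exact Or.inl h
  · exact Or.inr (Or.inl ⟨h, hk.trans hkl⟩)
  · exact Or.inr (Or.inr h)

theorem EntCopsMove.map {V W : Type*} [DecidableEq V] [DecidableEq W] (f : W ↪ V) {k : ℕ} {w : W}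
    {C C' : Finset W} (h : EntCopsMove k w C C') :
    EntCopsMove k (f w) (C.map f) (C'.map f) := by
  rcases h with rfl | ⟨rfl, h⟩ | ⟨x, hx, rfl⟩
  · exact Or.inl rfl
  · refine Or.inr (Or.inl ⟨Finset.map_insert f w C, ?_⟩)
    rwa [← Finset.map_insert, Finset.card_map]
  · refine Or.inr (Or.inr ⟨f x, Finset.mem_map_of_mem f hx, ?_⟩)
    rw [Finset.map_insert, Finset.map_erase]

/-- A Cops move remains legal when an extra cop is parked on a vertex `a`. -/
theorem EntCopsMove.insert {V : Type*} [DecidableEq V] {k : ℕ} {a w : V} {C C' : Finset V}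
    (h : EntCopsMove k w C C') (ha : a ∉ C) :
    EntCopsMove (k + 1) w (insert a C) (insert a C') := by
  rcases h with rfl | ⟨rfl, h⟩ | ⟨x, hx, rfl⟩
  · exact Or.inl rfl
  · refine Or.inr (Or.inl ⟨Finset.insert_comm a w C, ?_⟩)
    rw [Finset.insert_comm]
    exact (Finset.card_insert_le _ _).trans (Nat.succ_le_succ h)
  · have hax : a ≠ x := fun hax => ha (hax ▸ hx)
    refine Or.inr (Or.inr ⟨x, Finset.mem_insert_of_mem hx, ?_⟩)
    rw [Finset.erase_insert_of_ne hax, Finset.insert_comm]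

/-- A Cops move from `C` can be simulated from any larger set `D` of at most `k` cops. -/
theorem EntCopsMove.exists_superset {V : Type*} [DecidableEq V] {k : ℕ} {w : V}
    {C C' D : Finset V} (h : EntCopsMove k w C C') (hCD : C ⊆ D) (hD : D.card ≤ k) :
    ∃ D', EntCopsMove k w D D' ∧ C' ⊆ D' := by
  rcases h with rfl | ⟨rfl, h⟩ | ⟨x, hx, rfl⟩
  · exact ⟨D, Or.inl rfl, hCD⟩
  · by_cases hk : (Insert.insert w D).card ≤ k
    · exact ⟨_, Or.inr (Or.inl ⟨rfl, hk⟩), Finset.insert_subset_insert w hCD⟩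
    · have hwD : w ∉ D := fun hw => hk (by rwa [Finset.insert_eq_of_mem hw])
      rw [Finset.card_insert_of_notMem hwD] at hk
      rw [Finset.card_insert_of_notMem (fun hw => hwD (hCD hw))] at h
      obtain ⟨x, hxD, hxC⟩ := Finset.exists_mem_notMem_of_card_lt_card
        (show C.card < D.card by omega)
      exact ⟨_, Or.inr (Or.inr ⟨x, hxD, rfl⟩),
        Finset.insert_subset_insert w (Finset.subset_erase.2 ⟨hCD, hxC⟩)⟩
  · exact ⟨_, Or.inr (Or.inr ⟨x, hCD hx, rfl⟩),
      Finset.insert_subset_insert w (Finset.erase_subset_erase x hCD)⟩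

/-- Extra cops already on the board never hurt the Cops. -/
theorem EntCopsWinFrom.superset {V : Type*} [DecidableEq V] {E : V → V → Prop} {k : ℕ} {w : V}
    {C D : Finset V} (h : EntCopsWinFrom E k w C) (hCD : C ⊆ D) (hD : D.card ≤ k) :
    EntCopsWinFrom E k w D := by
  induction h generalizing D with
  | step w C C' hmove _ ih =>
    obtain ⟨D', hD', hsub⟩ := hmove.exists_superset hCD hD
    exact .step w D D' hD' fun u hu huD =>
      ih u hu (fun huC => huD (hsub huC)) hsub (hD'.card_le hD)

theorem entCopsWinFrom_card {V : Type*} [Fintype V] [DecidableEq V] (E : V → V → Prop) (w : V)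
    (C : Finset V) (hw : w ∉ C) : EntCopsWinFrom E (Fintype.card V) w C :=
  .step w C (insert w C) (Or.inr (Or.inl ⟨rfl, Finset.card_le_univ _⟩)) fun u _ hu =>
    entCopsWinFrom_card E u (insert w C) hu
termination_by Fintype.card V - C.card
decreasing_by
  have h₁ := Finset.card_le_univ (insert w C)
  have h₂ := Finset.card_insert_of_notMem hw
  omega

theorem entCopsWin_entanglement {V : Type*} [Finite V] [DecidableEq V] (E : V → V → Prop) :
    EntCopsWin E (entanglement E) := by
  have := Fintype.ofFinite V
  exact Nat.sInf_mem (s := {k | EntCopsWin E k})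
    ⟨Fintype.card V, fun w => entCopsWinFrom_card E w ∅ (Finset.notMem_empty w)⟩

/-- With one more cop parked on `a`, the Cops can play as on the graph without `a`. -/
theorem EntCopsWinFrom.insert_deleted {V : Type*} [DecidableEq V] {E : V → V → Prop} {a : V}
    {k : ℕ} {w : ({a}ᶜ : Set V)} {C : Finset ({a}ᶜ : Set V)}
    (h : EntCopsWinFrom (fun x y : ({a}ᶜ : Set V) => E x y) k w C) :
    EntCopsWinFrom E (k + 1) w (insert a (C.map (Function.Embedding.subtype _))) := by
  induction h with
  | step w C C' hmove _ ih =>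
    refine .step _ _ _ ((hmove.map (Function.Embedding.subtype _)).insert (by simp)) ?_
    intro u hu huC
    rw [Finset.mem_insert, not_or] at huC
    exact ih ⟨u, huC.1⟩ hu fun hmem => huC.2 (Finset.mem_map_of_mem _ hmem)

/-- If Robber visits `a` while `k` cops play on the graph without `a`, an extra cop placed on `a`
lets the Cops win. -/
theorem EntCopsWin.winFrom_deleted {V : Type*} [DecidableEq V] {E : V → V → Prop} {a : V} {k : ℕ}
    (h : EntCopsWin (fun x y : ({a}ᶜ : Set V) => E x y) k)
    {C : Finset ({a}ᶜ : Set V)} (hC : C.card ≤ k) :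
    EntCopsWinFrom E (k + 1) a (C.map (Function.Embedding.subtype _)) := by
  refine .step _ _ _ (Or.inr (Or.inl ⟨rfl, ?_⟩)) ?_
  · refine (Finset.card_insert_le _ _).trans ?_
    rw [Finset.card_map]
    exact Nat.succ_le_succ hC
  · intro u _ hu
    rw [Finset.mem_insert, not_or] at hu
    exact ((h ⟨u, hu.1⟩).superset (Finset.empty_subset C) hC).insert_deleted

theorem EntCopsWin.winFrom_of_winFrom {V : Type*} [DecidableEq V] {E : V → V → Prop} {a : V}
    {k : ℕ} (h : EntCopsWin (fun x y : ({a}ᶜ : Set V) => E x y) k)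
    {w : ({a}ᶜ : Set V)} {C : Finset ({a}ᶜ : Set V)}
    (hw : EntCopsWinFrom (fun x y : ({a}ᶜ : Set V) => E x y) k w C) (hC : C.card ≤ k) :
    EntCopsWinFrom E (k + 1) w (C.map (Function.Embedding.subtype _)) := by
  induction hw with
  | step w C C' hmove _ ih =>
    refine .step _ _ _ ((hmove.map (Function.Embedding.subtype _)).mono k.le_succ) ?_
    intro u hu huC
    by_cases hua : u = a
    · subst hua
      exact h.winFrom_deleted (hmove.card_le hC)
    · exact ih ⟨u, hua⟩ hu (fun hmem => huC (Finset.mem_map_of_mem _ hmem)) (hmove.card_le hC)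

/-- One additional cop compensates for putting back a deleted vertex. -/
theorem EntCopsWin.of_deleted {V : Type*} [DecidableEq V] {E : V → V → Prop} {a : V} {k : ℕ}
    (h : EntCopsWin (fun x y : ({a}ᶜ : Set V) => E x y) k) : EntCopsWin E (k + 1) := by
  intro w
  by_cases hwa : w = a
  · subst hwa
    exact h.winFrom_deleted (C := ∅) (Nat.zero_le k)
  · exact h.winFrom_of_winFrom (h ⟨w, hwa⟩) (C := ∅) (Nat.zero_le k)

/-- For every finite undirected graph `H` and vertex `v`,
`Ent(H) ≤ Ent(H \ v) + 1`, where `H \ v` is the graph induced on the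
complement of `{v}` (i.e. `H` with `v` and all incident edges deleted). -/
theorem entanglement_le_deleteVerts_add_one {V : Type*} [Fintype V]
    [DecidableEq V] (H : SimpleGraph V) (v : V) :
    entanglement H.Adj ≤ entanglement (H.induce ({v}ᶜ : Set V)).Adj + 1 := by
  exact Nat.sInf_le (EntCopsWin.of_deleted
    (entCopsWin_entanglement (H.induce ({v}ᶜ : Set V)).Adj))
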